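/- For every integer l ≥ 1, the polynomial p_l has exactly l distinct complex roots (all roots are simple), every root has strictly negative real part, and the set of roots is closed under complex conjugation. (These are the zeros of the modified Bessel function K_{l+1/2}.) -/

import Mathlib

open Polynomial

/-- The polynomial `p_l(z) = ∑_{k=0}^{l} ((l+k)! / (2^k k! (l−k)!)) z^{l−k}`. -/
noncomputable def pPoly (l : ℕ) : Polynomial ℂ :=
  ∑ k ∈ Finset.range (l + 1),
    C (((l + k).factorial : ℂ) / (2 ^ k * (k.factorial : ℂ) * ((l - k).factorial : ℂ))) *
      X ^ (l - k)

/-- The coefficient of `z ^ n` in `p_{n+j}`. -/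
theorem pPoly_coeff_add (n j : ℕ) : (pPoly (n + j)).coeff n =
    ((n + 2 * j).factorial : ℂ) / (2 ^ j * (j.factorial : ℂ) * (n.factorial : ℂ)) := by
  rw [pPoly, finsetSum_coeff, Finset.sum_eq_single j]
  · have h1 : n + j - j = n := by omega
    have h2 : n + j + j = n + 2 * j := by omega
    rw [h1, h2, coeff_C_mul_X_pow, if_pos rfl]
  · intro k hk hkj
    rw [Finset.mem_range] at hk
    rw [coeff_C_mul_X_pow, if_neg (by omega)]
  · intro h
    exact absurd (Finset.mem_range.2 (by omega)) h

theorem pPoly_coeff_of_lt {l n : ℕ} (h : l < n) : (pPoly l).coeff n = 0 := by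
  rw [pPoly, finsetSum_coeff]
  refine Finset.sum_eq_zero fun k _ => ?_
  rw [coeff_C_mul_X_pow, if_neg (by omega)]

theorem pPoly_coeff_self (l : ℕ) : (pPoly l).coeff l = 1 := by
  have h := pPoly_coeff_add l 0
  simpa [Nat.factorial_ne_zero] using h

theorem pPoly_zero : pPoly 0 = 1 := by
  simp [pPoly]

theorem pPoly_one : pPoly 1 = X + 1 := by
  simp [pPoly, Finset.sum_range_succ]

theorem pPoly_natDegree (l : ℕ) : (pPoly l).natDegree = l :=
  natDegree_eq_of_le_of_coeff_ne_zero
    (natDegree_le_iff_coeff_eq_zero.2 fun _ h => pPoly_coeff_of_lt h)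
    (by rw [pPoly_coeff_self]; exact one_ne_zero)

/-- The three-term recurrence of the reverse Bessel polynomials. -/
theorem pPoly_recurrence (l : ℕ) :
    pPoly (l + 2) = C (2 * l + 3 : ℂ) * pPoly (l + 1) + pPoly l * X ^ 2 := by
  ext n
  rw [coeff_add, coeff_C_mul, coeff_mul_X_pow']
  rcases lt_trichotomy n (l + 2) with h | rfl | h
  · obtain ⟨j, hj⟩ : ∃ j, l + 1 = n + j := ⟨l + 1 - n, by omega⟩
    have hl : (l : ℂ) = n + j - 1 := by
      rw [eq_sub_iff_add_eq]; exact_mod_cast hj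
    have hf := fun m : ℕ => (Nat.cast_ne_zero (R := ℂ)).2 (Nat.factorial_ne_zero m)
    rw [show l + 2 = n + (j + 1) by omega, hj, pPoly_coeff_add, pPoly_coeff_add, hl]
    have hfj := hf j
    have hj1 : (j : ℂ) + 1 ≠ 0 := Nat.cast_add_one_ne_zero j
    rcases n with _ | _ | m
    · rw [if_neg (by omega), show 0 + 2 * (j + 1) = 2 * j + 1 + 1 by omega, zero_add]
      simp only [Nat.factorial_succ]
      push_cast
      field_simp
      ring
    · rw [if_neg (by omega), show 0 + 1 + 2 * (j + 1) = 2 * j + 2 + 1 by omega,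
        show 0 + 1 + 2 * j = 2 * j + 1 by omega]
      simp only [Nat.factorial_succ]
      push_cast
      field_simp
      ring
    · have hfm := hf m
      have hm1 : (m : ℂ) + 1 ≠ 0 := Nat.cast_add_one_ne_zero m
      have hm2 : (m : ℂ) + 1 + 1 ≠ 0 := by
        exact_mod_cast Nat.cast_add_one_ne_zero (R := ℂ) (m + 1)
      rw [if_pos (by omega), show m + 1 + 1 - 2 = m by omega,
        show l = m + (j + 1) by omega, pPoly_coeff_add,
        show m + 1 + 1 + 2 * (j + 1) = m + 2 * j + 3 + 1 by omega,
        show m + 1 + 1 + 2 * j = m + 2 * j + 1 + 1 by omega,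
        show m + 2 * (j + 1) = m + 2 * j + 1 + 1 by omega]
      simp only [Nat.factorial_succ]
      push_cast
      field_simp
      ring
  · rw [pPoly_coeff_self, pPoly_coeff_of_lt (by omega), if_pos (by omega),
      Nat.add_sub_cancel, pPoly_coeff_self, mul_zero, zero_add]
  · rw [pPoly_coeff_of_lt h, pPoly_coeff_of_lt (by omega), if_pos (by omega),
      pPoly_coeff_of_lt (by omega), mul_zero, zero_add]

theorem derivative_pPoly_succ (l : ℕ) :
    derivative (pPoly (l + 1)) = pPoly (l + 1) - pPoly l * X := by
  ext n
  rw [coeff_derivative, coeff_sub]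
  have hf := fun m : ℕ => (Nat.cast_ne_zero (R := ℂ)).2 (Nat.factorial_ne_zero m)
  rcases n with _ | m
  · have hfl := hf l
    have hl1 : (l : ℂ) + 1 ≠ 0 := Nat.cast_add_one_ne_zero l
    have h0 := pPoly_coeff_add 0 (l + 1)
    rw [zero_add] at h0
    rw [mul_coeff_zero, coeff_X_zero, h0, add_comm l 1, zero_add, pPoly_coeff_add,
      show 0 + 2 * (1 + l) = 2 * l + 1 + 1 by omega, add_comm 1 l, show 1 + 2 * l = 2 * l + 1 by omega]
    simp only [Nat.factorial_succ]
    push_cast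
    field_simp
    ring
  · rw [coeff_mul_X]
    rcases lt_trichotomy m l with h | rfl | h
    · obtain ⟨j, rfl⟩ : ∃ j, l = m + (j + 1) := ⟨l - (m + 1), by omega⟩
      have hfj := hf j
      have hfm := hf m
      have hj1 : (j : ℂ) + 1 ≠ 0 := Nat.cast_add_one_ne_zero j
      have hm1 : (m : ℂ) + 1 ≠ 0 := Nat.cast_add_one_ne_zero m
      have hm2 : (m : ℂ) + 1 + 1 ≠ 0 := by
        exact_mod_cast Nat.cast_add_one_ne_zero (R := ℂ) (m + 1)
      rw [pPoly_coeff_add m, show m + (j + 1) + 1 = m + 1 + (j + 1) by omega,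
        pPoly_coeff_add (m + 1), show m + 1 + (j + 1) = m + 1 + 1 + j by omega,
        pPoly_coeff_add (m + 1 + 1),
        show m + 1 + 2 * (j + 1) = m + 2 * j + 2 + 1 by omega,
        show m + 1 + 1 + 2 * j = m + 2 * j + 1 + 1 by omega,
        show m + 2 * (j + 1) = m + 2 * j + 1 + 1 by omega]
      simp only [Nat.factorial_succ]
      push_cast
      field_simp
      ring
    · rw [pPoly_coeff_self, pPoly_coeff_self, pPoly_coeff_of_lt (by omega), zero_mul, sub_self]
    · rw [pPoly_coeff_of_lt (by omega), pPoly_coeff_of_lt (by omega), pPoly_coeff_of_lt h,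
        zero_mul, sub_self]

theorem eval_pPoly_recurrence (l : ℕ) (z : ℂ) : (pPoly (l + 2)).eval z =
    (2 * l + 3) * (pPoly (l + 1)).eval z + (pPoly l).eval z * z ^ 2 := by
  rw [pPoly_recurrence]
  simp

theorem eval_zero_pPoly_ne_zero (l : ℕ) : (pPoly l).eval 0 ≠ 0 := by
  have h := pPoly_coeff_add 0 l
  rw [zero_add] at h
  rw [← coeff_zero_eq_eval_zero, h]
  have hf := fun m : ℕ => (Nat.cast_ne_zero (R := ℂ)).2 (Nat.factorial_ne_zero m)
  exact div_ne_zero (hf _) (mul_ne_zero (mul_ne_zero (by simp) (hf _)) (hf _))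

/-- Consecutive polynomials `p_l`, `p_{l+1}` have no common root. -/
theorem eval_pPoly_ne_zero_of_succ (l : ℕ) {z : ℂ} (h : (pPoly (l + 1)).eval z = 0) :
    (pPoly l).eval z ≠ 0 := by
  induction l with
  | zero => simp [pPoly_zero]
  | succ l ih =>
    intro h'
    have hz : z ≠ 0 := by
      rintro rfl
      exact eval_zero_pPoly_ne_zero _ h
    rw [eval_pPoly_recurrence, h', mul_zero, zero_add] at h
    exact ih h' ((mul_eq_zero.1 h).resolve_right (pow_ne_zero 2 hz))

theorem eval_derivative_pPoly_ne_zero {l : ℕ} {z : ℂ} (h : (pPoly l).eval z = 0) :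
    (derivative (pPoly l)).eval z ≠ 0 := by
  cases l with
  | zero => simp [pPoly_zero] at h
  | succ l =>
    have hz : z ≠ 0 := by
      rintro rfl
      exact eval_zero_pPoly_ne_zero _ h
    rw [derivative_pPoly_succ, eval_sub, h, eval_mul, eval_X, zero_sub]
    exact neg_ne_zero.2 (mul_ne_zero (eval_pPoly_ne_zero_of_succ l h) hz)

theorem Complex.inv_re_pos {w : ℂ} (h : 0 < w.re) : 0 < w⁻¹.re := by
  have hw : w ≠ 0 := by
    rintro rfl
    simp at h
  rw [Complex.inv_re]
  exact div_pos h (Complex.normSq_pos.2 hw)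

/-- In the closed right half plane away from `0`, the ratio `p_{l+1}(z) / (z p_l(z))`
lies in the open right half plane. -/
theorem re_eval_pPoly_ratio_pos (l : ℕ) {z : ℂ} (hz : z ≠ 0) (hre : 0 ≤ z.re) :
    0 < ((pPoly (l + 1)).eval z / (z * (pPoly l).eval z)).re := by
  have hinv : 0 ≤ (z⁻¹).re := by
    rw [Complex.inv_re]
    exact div_nonneg hre (Complex.normSq_nonneg z)
  induction l with
  | zero =>
    have h : (pPoly (0 + 1)).eval z / (z * (pPoly 0).eval z) = 1 + z⁻¹ := by
      simp only [zero_add, pPoly_one, pPoly_zero, eval_add, eval_X, eval_one]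
      field_simp
    rw [h, Complex.add_re, Complex.one_re]
    linarith
  | succ l ih =>
    have h1 : (pPoly (l + 1)).eval z ≠ 0 := by
      intro h
      simp [h] at ih
    have h : (pPoly (l + 1 + 1)).eval z / (z * (pPoly (l + 1)).eval z) =
        ((2 * l + 3 : ℝ) : ℂ) * z⁻¹ + ((pPoly (l + 1)).eval z / (z * (pPoly l).eval z))⁻¹ := by
      rw [eval_pPoly_recurrence]
      push_cast
      field_simp
    rw [h, Complex.add_re, Complex.re_ofReal_mul]
    exact add_pos_of_nonneg_of_pos (mul_nonneg (by positivity) hinv) (Complex.inv_re_pos ih)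

theorem re_neg_of_eval_pPoly_eq_zero {l : ℕ} {z : ℂ} (h : (pPoly l).eval z = 0) :
    z.re < 0 := by
  by_contra! hre
  have hz : z ≠ 0 := by
    rintro rfl
    exact eval_zero_pPoly_ne_zero _ h
  cases l with
  | zero => simp [pPoly_zero] at h
  | succ l => simpa [h] using re_eval_pPoly_ratio_pos l hz hre

theorem eval_conj_pPoly (l : ℕ) (z : ℂ) :
    (pPoly l).eval (starRingEnd ℂ z) = starRingEnd ℂ ((pPoly l).eval z) := by
  simp [pPoly, eval_finsetSum, Complex.conj_ofNat]

/-- For every `l ≥ 1`, `p_l` has exactly `l` distinct complex roots, all simple, every root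
has strictly negative real part, and the set of roots is closed under complex conjugation.
These are the (nonzero) zeros of the modified Bessel function `K_{l+1/2}`. -/
theorem pPoly_roots (l : ℕ) (hl : 1 ≤ l) :
    (pPoly l).roots.toFinset.card = l ∧
    (∀ z : ℂ, (pPoly l).IsRoot z → (derivative (pPoly l)).eval z ≠ 0) ∧
    (∀ z : ℂ, (pPoly l).IsRoot z →
      z.re < 0 ∧ (pPoly l).IsRoot (starRingEnd ℂ z)) := by
  have hsimple : ∀ z : ℂ, (pPoly l).IsRoot z → (derivative (pPoly l)).eval z ≠ 0 :=
    fun z hz => eval_derivative_pPoly_ne_zero hz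
  refine ⟨?_, hsimple, fun z hz => ⟨re_neg_of_eval_pPoly_eq_zero hz, ?_⟩⟩
  · have hne : pPoly l ≠ 0 := by
      intro h
      have := pPoly_coeff_self l
      simp [h] at this
    have hnodup : (pPoly l).roots.Nodup := by
      rw [Multiset.nodup_iff_count_le_one]
      intro z
      rw [count_roots]
      by_contra! h
      obtain ⟨hz, hz'⟩ := (one_lt_rootMultiplicity_iff_isRoot hne).1 h
      exact hsimple z hz hz'
    rw [Multiset.toFinset_card_of_nodup hnodup,
      ← (IsAlgClosed.splits (pPoly l)).natDegree_eq_card_roots, pPoly_natDegree]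
  · rw [IsRoot, eval_conj_pPoly, hz, map_zero]
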